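/- Let N ≥ 2, 0 < s < 1 < p, N > sp, and θ ∈ ((N−sp)/(p−1), N/(p−1)). Then there exists ε₀ ∈ (0, 1/2] such that, with φ_θ the truncated power function with parameter ε₀, for every x ∈ ℝ^N with |x| ≥ 1 the fractional p-Laplacian (−Δ_p)^s φ_θ(x) exists in the principal-value sense with a strictly negative value. -/

import Mathlib

open MeasureTheory Filter Set

/-- `(-Δ_p)^s u(x)` exists in the principal-value sense with value `L`:
for every `r > 0` the integrand is integrable on `{y : |x - y| > r}`, and the
truncated integrals converge to `L` as `r → 0⁺`. -/
noncomputable def pvFracPLap (N : ℕ) (s p : ℝ) (u : EuclideanSpace ℝ (Fin N) → ℝ)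
    (x : EuclideanSpace ℝ (Fin N)) (L : ℝ) : Prop :=
  (∀ r : ℝ, 0 < r →
    IntegrableOn
      (fun y => |u x - u y| ^ (p - 2) * (u x - u y) * ‖x - y‖ ^ (-((N : ℝ) + s * p)))
      {y | r < ‖x - y‖} volume) ∧
  Tendsto
    (fun r : ℝ => ∫ y in {y : EuclideanSpace ℝ (Fin N) | r < ‖x - y‖},
        |u x - u y| ^ (p - 2) * (u x - u y) * ‖x - y‖ ^ (-((N : ℝ) + s * p)))
    (nhdsWithin 0 (Set.Ioi 0)) (nhds L)

/-- The truncated power function `φ_θ` with truncation parameter `ε₀`: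
`φ_θ(x) = |x|^{-θ}` for `|x| ≥ ε₀` and `φ_θ(x) = ε₀^{-θ}` for `|x| < ε₀`. -/
noncomputable def truncPow (N : ℕ) (θ ε₀ : ℝ) (x : EuclideanSpace ℝ (Fin N)) : ℝ :=
  if ε₀ ≤ ‖x‖ then ‖x‖ ^ (-θ) else ε₀ ^ (-θ)

/-- The open ball of radius `R` about the origin, without its centre. -/
def puncturedBall {E : Type*} [Norm E] (R : ℝ) : Set E := {y | 0 < ‖y‖ ∧ ‖y‖ < R}

/-- The pullback of an integrand under inversion in the sphere of radius `R`. -/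
noncomputable def invPullback {N : ℕ} (R : ℝ) (F : EuclideanSpace ℝ (Fin N) → ℝ)
    (y : EuclideanSpace ℝ (Fin N)) : ℝ :=
  (R / ‖y‖) ^ (2 * N) * F (EuclideanGeometry.inversion 0 R y)

lemma measurableSet_puncturedBall {N : ℕ} (R : ℝ) :
    MeasurableSet (puncturedBall R : Set (EuclideanSpace ℝ (Fin N))) :=
  (measurableSet_lt measurable_const measurable_norm).inter
    (measurableSet_lt measurable_norm measurable_const)

lemma norm_inversion_zero {N : ℕ} (R : ℝ) (y : EuclideanSpace ℝ (Fin N)) :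
    ‖EuclideanGeometry.inversion 0 R y‖ = R ^ 2 / ‖y‖ := by
  simpa using EuclideanGeometry.dist_inversion_center 0 y R

lemma norm_sub_inversion_zero {N : ℕ} {x y : EuclideanSpace ℝ (Fin N)} (hx : x ≠ 0) (hy : y ≠ 0) :
    ‖x - EuclideanGeometry.inversion 0 ‖x‖ y‖ = ‖x‖ * ‖x - y‖ / ‖y‖ := by
  have h := EuclideanGeometry.dist_inversion_inversion hx hy ‖x‖
  rw [EuclideanGeometry.inversion_of_mem_sphere (by simp)] at h
  simp only [dist_eq_norm, sub_zero] at h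
  rw [h]
  have := norm_ne_zero_iff.2 hx
  have := norm_ne_zero_iff.2 hy
  field_simp

lemma abs_det_fderiv_inversion {N : ℕ} (R : ℝ) (y : EuclideanSpace ℝ (Fin N)) :
    |((R / dist y 0) ^ 2 • ((ℝ ∙ (y - 0))ᗮ.reflection :
      EuclideanSpace ℝ (Fin N) →L[ℝ] EuclideanSpace ℝ (Fin N))).det| = (R / ‖y‖) ^ (2 * N) := by
  have h : |(((ℝ ∙ (y - 0))ᗮ.reflection :
      EuclideanSpace ℝ (Fin N) →L[ℝ] EuclideanSpace ℝ (Fin N))).det| = 1 := by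
    change |LinearMap.det (ℝ ∙ (y - 0))ᗮ.reflection.toLinearMap| = 1
    rw [Submodule.det_reflection]
    simp
  rw [ContinuousLinearMap.det, ContinuousLinearMap.toLinearMap_smul, LinearMap.det_smul, abs_mul,
    ← ContinuousLinearMap.det, h, finrank_euclideanSpace_fin, mul_one, ← pow_mul, dist_zero_right]
  exact abs_of_nonneg (by rw [pow_mul]; positivity)

section

variable {N : ℕ} {x : EuclideanSpace ℝ (Fin N)}

lemma image_inversion_puncturedBall (hx : x ≠ 0) (r : ℝ) :
    EuclideanGeometry.inversion 0 ‖x‖ ''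
        (puncturedBall ‖x‖ ∩ {y | r * ‖y‖ < ‖x‖ * ‖x - y‖}) =
      {y | ‖x‖ < ‖y‖ ∧ r < ‖x - y‖} := by
  have hR : 0 < ‖x‖ := norm_pos_iff.2 hx
  have hinv := EuclideanGeometry.inversion_inversion (0 : EuclideanSpace ℝ (Fin N)) hR.ne'
  ext z
  constructor
  · rintro ⟨y, ⟨⟨hy0, hyR⟩, hy⟩, rfl⟩
    refine ⟨?_, ?_⟩
    · rw [norm_inversion_zero, lt_div_iff₀ hy0]
      nlinarith
    · rw [norm_sub_inversion_zero hx (norm_pos_iff.1 hy0), lt_div_iff₀ hy0]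
      exact hy
  · rintro ⟨hz, hzr⟩
    have hz0 : 0 < ‖z‖ := hR.trans hz
    refine ⟨EuclideanGeometry.inversion 0 ‖x‖ z, ⟨⟨?_, ?_⟩, ?_⟩, hinv z⟩
    · rw [norm_inversion_zero]; positivity
    · rw [norm_inversion_zero, div_lt_iff₀ hz0]
      nlinarith
    · rw [mem_ofPred_eq]
      rw [norm_inversion_zero, norm_sub_inversion_zero hx (norm_pos_iff.1 hz0)]
      have : 0 < ‖x‖ ^ 2 / ‖z‖ := by positivity
      calc r * (‖x‖ ^ 2 / ‖z‖) < ‖x - z‖ * (‖x‖ ^ 2 / ‖z‖) := by gcongr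
        _ = _ := by ring

lemma measurableSet_inversion_domain (r : ℝ) :
    MeasurableSet (puncturedBall ‖x‖ ∩ {y | r * ‖y‖ < ‖x‖ * ‖x - y‖}) :=
  (measurableSet_puncturedBall _).inter
    (measurableSet_lt (by fun_prop) (by fun_prop))

lemma integrableOn_and_integral_invPullback (hx : x ≠ 0)
    (F : EuclideanSpace ℝ (Fin N) → ℝ) (r : ℝ) :
    (IntegrableOn F {y | ‖x‖ < ‖y‖ ∧ r < ‖x - y‖} ↔
      IntegrableOn (invPullback ‖x‖ F)
        (puncturedBall ‖x‖ ∩ {y | r * ‖y‖ < ‖x‖ * ‖x - y‖})) ∧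
    ∫ y in {y | ‖x‖ < ‖y‖ ∧ r < ‖x - y‖}, F y =
      ∫ y in puncturedBall ‖x‖ ∩ {y | r * ‖y‖ < ‖x‖ * ‖x - y‖}, invPullback ‖x‖ F y := by
  have hR : ‖x‖ ≠ 0 := norm_ne_zero_iff.2 hx
  have hm := measurableSet_inversion_domain (x := x) r
  have hd : ∀ y ∈ puncturedBall ‖x‖ ∩ {y | r * ‖y‖ < ‖x‖ * ‖x - y‖},
      HasFDerivWithinAt (EuclideanGeometry.inversion 0 ‖x‖)
        ((‖x‖ / dist y 0) ^ 2 • ((ℝ ∙ (y - 0))ᗮ.reflection :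
          EuclideanSpace ℝ (Fin N) →L[ℝ] EuclideanSpace ℝ (Fin N)))
        (puncturedBall ‖x‖ ∩ {y | r * ‖y‖ < ‖x‖ * ‖x - y‖}) y := fun y hy =>
    (EuclideanGeometry.hasFDerivAt_inversion (norm_pos_iff.1 hy.1.1)).hasFDerivWithinAt
  have hinj := (EuclideanGeometry.inversion_injective
    (0 : EuclideanSpace ℝ (Fin N)) hR).injOn
      (s := puncturedBall ‖x‖ ∩ {y | r * ‖y‖ < ‖x‖ * ‖x - y‖})
  rw [← image_inversion_puncturedBall hx r]
  constructor
  · rw [integrableOn_image_iff_integrableOn_abs_det_fderiv_smul volume hm hd hinj]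
    simp only [abs_det_fderiv_inversion, smul_eq_mul]
    rfl
  · rw [integral_image_eq_integral_abs_det_fderiv_smul volume hm hd hinj]
    simp only [abs_det_fderiv_inversion, smul_eq_mul]
    rfl

end

lemma setIntegral_compl_ball_eq {N : ℕ} [NeZero N] {x : EuclideanSpace ℝ (Fin N)} (hx : x ≠ 0)
    {F : EuclideanSpace ℝ (Fin N) → ℝ}
    {r : ℝ} (hr : 0 < r) (hF : IntegrableOn F {y | r < ‖x - y‖}) :
    IntegrableOn (fun y => F y + invPullback ‖x‖ F y) (puncturedBall ‖x‖ ∩ {y | r < ‖x - y‖}) ∧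
    ∫ y in {y | r < ‖x - y‖}, F y =
      (∫ y in puncturedBall ‖x‖ ∩ {y | r < ‖x - y‖}, (F y + invPullback ‖x‖ F y)) +
        ∫ y in (puncturedBall ‖x‖ ∩ {y | r * ‖y‖ < ‖x‖ * ‖x - y‖}) \ {y | r < ‖x - y‖},
          invPullback ‖x‖ F y := by
  have hR : 0 < ‖x‖ := norm_pos_iff.2 hx
  have hmr : MeasurableSet {y | r < ‖x - y‖} := measurableSet_lt (by fun_prop) (by fun_prop)
  have hm1 := (measurableSet_puncturedBall ‖x‖).inter hmr
  have hm2 : MeasurableSet {y | ‖x‖ < ‖y‖ ∧ r < ‖x - y‖} :=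
    (measurableSet_lt measurable_const measurable_norm).inter hmr
  obtain ⟨hi, he⟩ := integrableOn_and_integral_invPullback hx F r
  have hF1 : IntegrableOn F (puncturedBall ‖x‖ ∩ {y | r < ‖x - y‖}) :=
    hF.mono_set inter_subset_right
  have hF2 : IntegrableOn F {y | ‖x‖ < ‖y‖ ∧ r < ‖x - y‖} := hF.mono_set fun y hy => hy.2
  have hB := hi.1 hF2
  have hsub : puncturedBall ‖x‖ ∩ {y | r < ‖x - y‖} ⊆
      puncturedBall ‖x‖ ∩ {y | r * ‖y‖ < ‖x‖ * ‖x - y‖} := by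
    rintro y ⟨hy, hyr : r < _⟩
    refine ⟨hy, ?_⟩
    rw [mem_ofPred_eq]
    have := hy.2
    nlinarith [norm_nonneg y]
  have hB1 := hB.mono_set hsub
  refine ⟨hF1.add hB1, ?_⟩
  have hae : ({y | r < ‖x - y‖} : Set (EuclideanSpace ℝ (Fin N))) =ᵐ[volume]
      ((puncturedBall ‖x‖ ∩ {y | r < ‖x - y‖}) ∪ {y | ‖x‖ < ‖y‖ ∧ r < ‖x - y‖} :
        Set (EuclideanSpace ℝ (Fin N))) := by
    have h0 : ∀ᵐ y : EuclideanSpace ℝ (Fin N), y ∉ Metric.sphere 0 ‖x‖ :=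
      measure_eq_zero_iff_ae_notMem.1 (Measure.addHaar_sphere_of_ne_zero volume 0 hR.ne')
    have h1 : ∀ᵐ y : EuclideanSpace ℝ (Fin N), y ≠ 0 := Measure.ae_ne volume 0
    filter_upwards [h0, h1] with y hy hy0
    refine propext ⟨fun h => ?_, fun h => h.elim (·.2) (·.2)⟩
    rcases lt_trichotomy ‖y‖ ‖x‖ with hlt | heq | hgt
    · exact Or.inl ⟨⟨norm_pos_iff.2 hy0, hlt⟩, h⟩
    · exact absurd (by simpa using heq) hy
    · exact Or.inr ⟨hgt, h⟩
  rw [setIntegral_congr_set hae, setIntegral_union _ hm2 hF1 hF2, he,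
    integral_add hF1 hB1, add_assoc]
  · congr 1
    have hd := setIntegral_sdiff hm1 hB hsub
    rw [eq_sub_iff_add_eq'] at hd
    rw [← hd]
    congr 2
    congr 1
    ext y
    simp only [Set.mem_sdiff, mem_inter_iff]
    tauto
  · rw [Set.disjoint_left]
    rintro y hy1 hy2
    exact lt_asymm hy1.1.2 hy2.1

lemma integrableOn_ball_norm_sub_rpow {N : ℕ} [NeZero N] (x : EuclideanSpace ℝ (Fin N))
    {a : ℝ} (ha : a < N) (ρ : ℝ) :
    IntegrableOn (fun y => ‖x - y‖ ^ (-a)) (Metric.ball x ρ) := by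
  have h : IntegrableOn (fun z : EuclideanSpace ℝ (Fin N) => ‖z‖ ^ (-a)) (Metric.ball 0 ρ) :=
    integrableOn_ball_of_norm_le_rpow (C := 1) (α := a)
      (by simpa using NeZero.one_le) (by simpa using ha)
      (Eventually.of_forall fun z => by
        rw [one_mul, Real.norm_of_nonneg (by positivity)])
      (Measurable.aestronglyMeasurable (by fun_prop))
  rw [← integrable_indicator_iff Metric.isOpen_ball.measurableSet] at h ⊢
  refine (h.comp_sub_left x).congr (Eventually.of_forall fun y => ?_)
  simp only [indicator, Metric.mem_ball, dist_comm y x, dist_eq_norm, sub_zero]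

lemma integrableOn_compl_ball_norm_sub_rpow {N : ℕ} (x : EuclideanSpace ℝ (Fin N))
    {c : ℝ} (hc : (N : ℝ) < c) {r : ℝ} (hr : 0 < r) :
    IntegrableOn (fun y => ‖x - y‖ ^ (-c)) {y | r < ‖x - y‖} := by
  have hc0 : 0 ≤ c := (Nat.cast_nonneg N).trans hc.le
  have h : Integrable fun z : EuclideanSpace ℝ (Fin N) => (1 + ‖z‖) ^ (-c) :=
    integrable_one_add_norm (by simpa using hc)
  have hm : MeasurableSet {y | r < ‖x - y‖} := measurableSet_lt (by fun_prop) (by fun_prop)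
  refine Integrable.mono' ((h.comp_sub_left x).integrableOn.const_mul ((r / (1 + r)) ^ (-c)))
    (Measurable.aestronglyMeasurable (by fun_prop)) ?_
  filter_upwards [ae_restrict_mem hm] with y (hy : r < ‖x - y‖)
  rw [Real.norm_of_nonneg (by positivity), ← Real.mul_rpow (by positivity) (by positivity)]
  refine Real.rpow_le_rpow_of_nonpos (by positivity) ?_ (by linarith)
  rw [div_mul_eq_mul_div, div_le_iff₀ (by positivity)]
  nlinarith

lemma measurable_invPullback {N : ℕ} (R : ℝ) {F : EuclideanSpace ℝ (Fin N) → ℝ}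
    (hF : Measurable F) : Measurable (invPullback R F) := by
  have h : Measurable (EuclideanGeometry.inversion (0 : EuclideanSpace ℝ (Fin N)) R) := by
    simp only [EuclideanGeometry.inversion_def]
    simp only [vsub_eq_sub, sub_zero, vadd_eq_add, add_zero, dist_zero_right]
    fun_prop
  unfold invPullback
  exact (by fun_prop : Measurable fun y : EuclideanSpace ℝ (Fin N) => (R / ‖y‖) ^ (2 * N)).mul
    (hF.comp h)

/-- The shell on which the image of a punctured neighbourhood of `x` under inversion and the
neighbourhood itself differ is one order smaller than a ball. -/
lemma volume_inversion_shell_le {N : ℕ} {x : EuclideanSpace ℝ (Fin N)} {r : ℝ} (hr : 0 < r)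
    (hrx : r ≤ ‖x‖ / 2) :
    volume.real (Metric.closedBall x r \ Metric.closedBall x (r * (1 - r / ‖x‖))) ≤
      N * r ^ (N + 1) / ‖x‖ * volume.real (Metric.ball (0 : EuclideanSpace ℝ (Fin N)) 1) := by
  have hR : 0 < ‖x‖ := by linarith
  have hq : r / ‖x‖ ≤ 1 / 2 := by rw [div_le_iff₀ hR]; linarith
  have hq0 : 0 < r / ‖x‖ := by positivity
  have hnn : 0 ≤ r * (1 - r / ‖x‖) := mul_nonneg hr.le (by linarith)
  rw [measureReal_sdiff (Metric.closedBall_subset_closedBall (by nlinarith))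
    Metric.isClosed_closedBall.measurableSet
    (Metric.isBounded_closedBall.measure_lt_top.ne), Measure.addHaar_real_closedBall _ _ hr.le,
    Measure.addHaar_real_closedBall _ _ hnn, ← sub_mul, finrank_euclideanSpace_fin]
  refine mul_le_mul_of_nonneg_right ?_ measureReal_nonneg
  have hb := one_add_mul_le_pow (a := -(r / ‖x‖)) (by linarith) N
  rw [mul_pow]
  calc r ^ N - r ^ N * (1 - r / ‖x‖) ^ N = r ^ N * (1 - (1 + -(r / ‖x‖)) ^ N) := by ring
    _ ≤ r ^ N * (N * (r / ‖x‖)) := by gcongr; linarith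
    _ = _ := by ring

lemma tendsto_pv_of_inversion {N : ℕ} [NeZero N] {x : EuclideanSpace ℝ (Fin N)} (hx : x ≠ 0)
    {F : EuclideanSpace ℝ (Fin N) → ℝ} (hFm : Measurable F)
    (hF : ∀ r, 0 < r → IntegrableOn F {y | r < ‖x - y‖})
    {ρ C a : ℝ} (hρ : 0 < ρ) (ha : a < N)
    (hG : ∀ y ∈ puncturedBall ‖x‖, ‖x - y‖ < ρ →
      |F y + invPullback ‖x‖ F y| ≤ C * ‖x - y‖ ^ (-a))
    {C' b c : ℝ} (hC' : 0 ≤ C') (hb : 0 ≤ b) (hc : 0 ≤ c) (hbc : c < N + 1 + b)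
    (hB : ∀ y ∈ puncturedBall ‖x‖, ‖x - y‖ < ρ →
      |invPullback ‖x‖ F y| ≤ C' * (‖x - y‖ ^ b * ‖x - y‖ ^ (-c))) :
    IntegrableOn (fun y => F y + invPullback ‖x‖ F y) (puncturedBall ‖x‖) ∧
    Tendsto (fun r : ℝ => ∫ y in {y | r < ‖x - y‖}, F y) (nhdsWithin 0 (Set.Ioi 0))
      (nhds (∫ y in puncturedBall ‖x‖, (F y + invPullback ‖x‖ F y))) := by
  have hR : 0 < ‖x‖ := norm_pos_iff.2 hx
  have hmD := measurableSet_puncturedBall (N := N) ‖x‖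
  have hmr : ∀ r : ℝ, MeasurableSet {y | r < ‖x - y‖} := fun r =>
    measurableSet_lt (by fun_prop) (by fun_prop)
  have hGm : Measurable (fun y => F y + invPullback ‖x‖ F y) :=
    hFm.add (measurable_invPullback _ hFm)
  have hnear : IntegrableOn (fun y => F y + invPullback ‖x‖ F y)
      (puncturedBall ‖x‖ ∩ Metric.ball x ρ) := by
    refine Integrable.mono' (((integrableOn_ball_norm_sub_rpow x ha ρ).mono_set
      inter_subset_right).const_mul C) hGm.aestronglyMeasurable ?_
    filter_upwards [ae_restrict_mem (hmD.inter Metric.isOpen_ball.measurableSet)] with y hy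
    refine hG y hy.1 ?_
    have := hy.2
    rwa [Metric.mem_ball, dist_comm, dist_eq_norm] at this
  have hint : IntegrableOn (fun y => F y + invPullback ‖x‖ F y) (puncturedBall ‖x‖) := by
    have hfar := (setIntegral_compl_ball_eq hx (half_pos hρ) (hF _ (half_pos hρ))).1
    refine (hnear.union hfar).mono_set fun y hy => ?_
    rcases lt_or_ge ‖x - y‖ ρ with h | h
    · exact Or.inl ⟨hy, by rwa [Metric.mem_ball, dist_comm, dist_eq_norm]⟩
    · exact Or.inr ⟨hy, (half_lt_self hρ).trans_le h⟩
  refine ⟨hint, ?_⟩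
  have h1 : Tendsto (fun r : ℝ => ∫ y in puncturedBall ‖x‖ ∩ {y | r < ‖x - y‖},
      (F y + invPullback ‖x‖ F y)) (nhdsWithin 0 (Set.Ioi 0))
      (nhds (∫ y in puncturedBall ‖x‖, (F y + invPullback ‖x‖ F y))) := by
    have hcov : AECover (volume.restrict (puncturedBall ‖x‖)) (nhdsWithin (0 : ℝ) (Set.Ioi 0))
        (fun r : ℝ => {y : EuclideanSpace ℝ (Fin N) | r < ‖x - y‖}) := by
      refine ⟨?_, hmr⟩
      filter_upwards [ae_restrict_mem hmD] with y hy
      have hxy : 0 < ‖x - y‖ := by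
        rw [norm_pos_iff, sub_ne_zero]
        rintro rfl
        exact lt_irrefl _ hy.2
      filter_upwards [Ioo_mem_nhdsGT hxy] with r hr using hr.2
    have := hcov.integral_tendsto_of_countably_generated hint
    simpa only [Measure.restrict_restrict (hmr _), inter_comm] using this
  have h2 : Tendsto (fun r : ℝ => ∫ y in (puncturedBall ‖x‖ ∩
      {y | r * ‖y‖ < ‖x‖ * ‖x - y‖}) \ {y | r < ‖x - y‖}, invPullback ‖x‖ F y)
      (nhdsWithin 0 (Set.Ioi 0)) (nhds 0) := by
    set V := volume.real (Metric.ball (0 : EuclideanSpace ℝ (Fin N)) 1)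
    have hlim : Tendsto (fun r : ℝ => C' * 2 ^ c * N / ‖x‖ * V * r ^ (N + 1 + b - c))
        (nhdsWithin 0 (Set.Ioi 0)) (nhds 0) := by
      have := (Real.continuousAt_rpow_const 0 (N + 1 + b - c)
        (Or.inr (by linarith))).tendsto.const_mul (C' * 2 ^ c * N / ‖x‖ * V)
      rw [Real.zero_rpow (by linarith), mul_zero] at this
      exact this.mono_left nhdsWithin_le_nhds
    refine squeeze_zero_norm' ?_ hlim
    filter_upwards [Ioo_mem_nhdsGT (lt_min (half_pos hR) hρ)] with r hr
    have hr0 : 0 < r := hr.1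
    have hrR : r < ‖x‖ / 2 := hr.2.trans_le (min_le_left _ _)
    have hrρ : r < ρ := hr.2.trans_le (min_le_right _ _)
    have hq : r / ‖x‖ ≤ 1 / 2 := by rw [div_le_iff₀ hR]; linarith
    have hshell : ∀ y ∈ (puncturedBall ‖x‖ ∩
        {y | r * ‖y‖ < ‖x‖ * ‖x - y‖}) \ {y | r < ‖x - y‖},
        ‖x - y‖ ≤ r ∧ r * (1 - r / ‖x‖) < ‖x - y‖ := by
      rintro y ⟨⟨hy, hy1 : r * ‖y‖ < ‖x‖ * ‖x - y‖⟩, hy2⟩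
      have hy2' : ‖x - y‖ ≤ r := not_lt.1 hy2
      refine ⟨hy2', ?_⟩
      have h3 := norm_sub_norm_le x y
      rw [show r * (1 - r / ‖x‖) = r * (‖x‖ - r) / ‖x‖ by field_simp, div_lt_iff₀ hR]
      nlinarith
    refine (norm_setIntegral_le_of_norm_le_const (C := C' * (r ^ b * (r / 2) ^ (-c))) ?_ ?_).trans ?_
    · refine (measure_mono (t := Metric.closedBall x r) fun y hy => ?_).trans_lt
        Metric.isBounded_closedBall.measure_lt_top
      rw [Metric.mem_closedBall, dist_comm, dist_eq_norm]
      exact (hshell y hy).1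
    · intro y hy
      obtain ⟨hy1, hy2⟩ := hshell y hy
      have hy3 : r / 2 ≤ ‖x - y‖ := by nlinarith
      refine (hB y hy.1.1 (hy1.trans_lt hrρ)).trans ?_
      gcongr ?_ * (?_ * ?_)
      · exact Real.rpow_le_rpow (norm_nonneg _) hy1 hb
      · exact Real.rpow_le_rpow_of_nonpos (by positivity) hy3 (by linarith)
    · have hvol : volume.real ((puncturedBall ‖x‖ ∩
          {y | r * ‖y‖ < ‖x‖ * ‖x - y‖}) \ {y | r < ‖x - y‖}) ≤
          N * r ^ (N + 1) / ‖x‖ * V := by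
        refine (measureReal_mono (fun y hy => ?_) ?_).trans
          (volume_inversion_shell_le hr0 hrR.le)
        · obtain ⟨hy1, hy2⟩ := hshell y hy
          rw [Set.mem_sdiff, Metric.mem_closedBall, Metric.mem_closedBall, dist_comm, dist_eq_norm]
          exact ⟨hy1, not_le.2 hy2⟩
        · exact (Metric.isBounded_closedBall.subset sdiff_subset).measure_lt_top.ne
      calc C' * (r ^ b * (r / 2) ^ (-c)) * volume.real ((puncturedBall ‖x‖ ∩
            {y | r * ‖y‖ < ‖x‖ * ‖x - y‖}) \ {y | r < ‖x - y‖})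
          ≤ C' * (r ^ b * (r / 2) ^ (-c)) * (N * r ^ (N + 1) / ‖x‖ * V) := by gcongr
        _ = C' * 2 ^ c * N / ‖x‖ * V * r ^ (N + 1 + b - c) := by
          have e1 : (r / 2) ^ (-c) = r ^ (-c) * 2 ^ c := by
            rw [Real.div_rpow hr0.le (by norm_num), Real.rpow_neg (by norm_num : (0:ℝ) ≤ 2),
              div_inv_eq_mul]
          have e2 : r ^ (N + 1 + b - c) = r ^ (N + 1) * r ^ b * r ^ (-c) := by
            rw [sub_eq_add_neg, Real.rpow_add hr0, Real.rpow_add hr0, ← Real.rpow_natCast]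
            push_cast
            rfl
          rw [e1, e2]
          ring
  have h3 := h1.add h2
  rw [add_zero] at h3
  refine h3.congr' ?_
  filter_upwards [self_mem_nhdsWithin] with r hr
  exact (setIntegral_compl_ball_eq hx hr (hF r hr)).2.symm

lemma abs_rpow_sub_two_mul_of_nonneg {a p : ℝ} (ha : 0 ≤ a) (hp : 1 < p) :
    |a| ^ (p - 2) * a = a ^ (p - 1) := by
  rcases ha.eq_or_lt with rfl | ha
  · rw [mul_zero, Real.zero_rpow (by linarith)]
  · rw [abs_of_pos ha]
    nth_rewrite 2 [← Real.rpow_one a]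
    rw [← Real.rpow_add ha]
    ring_nf

lemma abs_rpow_sub_two_mul_of_nonpos {a p : ℝ} (ha : a ≤ 0) (hp : 1 < p) :
    |a| ^ (p - 2) * a = -(-a) ^ (p - 1) := by
  rw [← abs_rpow_sub_two_mul_of_nonneg (neg_nonneg.2 ha) hp, abs_neg]
  ring

lemma exists_abs_one_sub_rpow_le (a : ℝ) :
    ∃ C : ℝ, 0 ≤ C ∧ ∀ t ∈ Icc (1 / 2 : ℝ) 1, |1 - t ^ a| ≤ C * (1 - t) := by
  have hcont : ContinuousOn (fun t : ℝ => a * t ^ (a - 1)) (Icc (1 / 2 : ℝ) 1) :=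
    continuousOn_const.mul (continuousOn_id.rpow_const fun t ht =>
      Or.inl (by have := ht.1; simp only [id]; linarith))
  obtain ⟨C, hC⟩ := isCompact_Icc.exists_bound_of_continuousOn hcont
  refine ⟨C, (norm_nonneg _).trans (hC 1 (by norm_num)), fun t ht => ?_⟩
  have := Convex.norm_image_sub_le_of_norm_hasDerivWithin_le (f := fun t : ℝ => t ^ a)
    (fun u hu => (Real.hasDerivAt_rpow_const (p := a)
      (Or.inl (by have := hu.1; linarith))).hasDerivWithinAt) hC (convex_Icc _ _) ht
    (right_mem_Icc.2 (by norm_num))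
  rw [Real.one_rpow, Real.norm_eq_abs, Real.norm_eq_abs] at this
  rwa [abs_of_nonneg (by linarith [ht.2] : 0 ≤ 1 - t)] at this

/-- The integrand defining `(-Δ_p)^s u(x)`. -/
noncomputable def pvIntegrand (N : ℕ) (s p : ℝ) (u : EuclideanSpace ℝ (Fin N) → ℝ)
    (x y : EuclideanSpace ℝ (Fin N)) : ℝ :=
  |u x - u y| ^ (p - 2) * (u x - u y) * ‖x - y‖ ^ (-((N : ℝ) + s * p))

section

variable {N : ℕ} {s p θ ε : ℝ}

lemma truncPow_of_le {y : EuclideanSpace ℝ (Fin N)} (hy : ε ≤ ‖y‖) :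
    truncPow N θ ε y = ‖y‖ ^ (-θ) := if_pos hy

lemma truncPow_nonneg (hε : 0 < ε) (y : EuclideanSpace ℝ (Fin N)) : 0 ≤ truncPow N θ ε y := by
  unfold truncPow
  split_ifs <;> positivity

lemma truncPow_le (hε : 0 < ε) (hθ : 0 < θ) (y : EuclideanSpace ℝ (Fin N)) :
    truncPow N θ ε y ≤ ε ^ (-θ) := by
  unfold truncPow
  split_ifs with h
  · exact Real.rpow_le_rpow_of_nonpos hε h (by linarith)
  · exact le_rfl

lemma truncPow_anti (hε : 0 < ε) (hθ : 0 < θ) {x y : EuclideanSpace ℝ (Fin N)} (hx : ε ≤ ‖x‖)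
    (hxy : ‖y‖ ≤ ‖x‖) : truncPow N θ ε x ≤ truncPow N θ ε y := by
  rw [truncPow_of_le hx]
  unfold truncPow
  split_ifs with h
  · exact Real.rpow_le_rpow_of_nonpos (hε.trans_le h) hxy (by linarith)
  · exact Real.rpow_le_rpow_of_nonpos hε hx (by linarith)

lemma measurable_truncPow : Measurable (truncPow N θ ε) :=
  Measurable.ite (measurableSet_le measurable_const measurable_norm) (by fun_prop)
    measurable_const

lemma measurable_pvIntegrand (x : EuclideanSpace ℝ (Fin N)) :
    Measurable (pvIntegrand N s p (truncPow N θ ε) x) := by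
  have := measurable_truncPow (N := N) (θ := θ) (ε := ε)
  unfold pvIntegrand
  fun_prop

lemma integrableOn_pvIntegrand (hs : 0 < s) (hp : 1 < p) (hε : 0 < ε) (hθ : 0 < θ)
    (x : EuclideanSpace ℝ (Fin N)) {r : ℝ} (hr : 0 < r) :
    IntegrableOn (pvIntegrand N s p (truncPow N θ ε) x) {y | r < ‖x - y‖} := by
  have hsp : 0 < s * p := mul_pos hs (by linarith)
  refine Integrable.mono' ((integrableOn_compl_ball_norm_sub_rpow x
    (by linarith : (N : ℝ) < N + s * p) hr).const_mul ((ε ^ (-θ)) ^ (p - 1)))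
    (measurable_pvIntegrand x).aestronglyMeasurable (Eventually.of_forall fun y => ?_)
  rw [pvIntegrand, norm_mul, Real.norm_of_nonneg (by positivity : 0 ≤ ‖x - y‖ ^ (-(N + s * p)))]
  refine mul_le_mul_of_nonneg_right ?_ (by positivity)
  set d := truncPow N θ ε x - truncPow N θ ε y with hd
  have hle : |d| ≤ ε ^ (-θ) := abs_sub_le_of_nonneg_of_le (truncPow_nonneg hε x)
    (truncPow_le hε hθ x) (truncPow_nonneg hε y) (truncPow_le hε hθ y)
  have h1 : ‖|d| ^ (p - 2) * d‖ = |d| ^ (p - 1) := by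
    rw [← abs_rpow_sub_two_mul_of_nonneg (abs_nonneg d) hp, norm_mul, Real.norm_eq_abs,
      Real.norm_eq_abs, abs_abs, abs_of_nonneg (by positivity : 0 ≤ |d| ^ (p - 2))]
  rw [h1]
  exact Real.rpow_le_rpow (abs_nonneg d) hle (by linarith)

variable {x y : EuclideanSpace ℝ (Fin N)}

lemma pvIntegrand_nonpos (hp : 1 < p) (hε : 0 < ε) (hθ : 0 < θ) (hx : ε ≤ ‖x‖)
    (hy : ‖y‖ ≤ ‖x‖) : pvIntegrand N s p (truncPow N θ ε) x y ≤ 0 := by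
  have h := truncPow_anti hε hθ hx hy
  rw [pvIntegrand, abs_rpow_sub_two_mul_of_nonpos (by linarith) hp, neg_mul, neg_nonpos]
  have : 0 ≤ -(truncPow N θ ε x - truncPow N θ ε y) := by linarith
  positivity

lemma pvIntegrand_eq (hp : 1 < p) (hε : 0 < ε) (hθ : 0 < θ) (hx : ε ≤ ‖x‖) (hy : ε ≤ ‖y‖)
    (hyx : ‖y‖ ≤ ‖x‖) :
    pvIntegrand N s p (truncPow N θ ε) x y =
      -((‖x‖ ^ (-θ)) ^ (p - 1) * (1 - (‖y‖ / ‖x‖) ^ θ) ^ (p - 1) *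
        (‖y‖ / ‖x‖) ^ (-(θ * (p - 1))) * ‖x - y‖ ^ (-(N + s * p))) := by
  have hx0 : 0 < ‖x‖ := hε.trans_le hx
  have hy0 : 0 < ‖y‖ := hε.trans_le hy
  have h := truncPow_anti hε hθ hx hyx
  have ht : 0 < ‖y‖ / ‖x‖ := by positivity
  have ht1 : 0 ≤ 1 - (‖y‖ / ‖x‖) ^ θ := sub_nonneg.2
    (Real.rpow_le_one ht.le ((div_le_one hx0).2 hyx) hθ.le)
  rw [pvIntegrand, abs_rpow_sub_two_mul_of_nonpos (by linarith) hp, truncPow_of_le hx,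
    truncPow_of_le hy]
  have e : -(‖x‖ ^ (-θ) - ‖y‖ ^ (-θ)) =
      ‖x‖ ^ (-θ) * (1 - (‖y‖ / ‖x‖) ^ θ) * (‖y‖ / ‖x‖) ^ (-θ) := by
    have e1 : (‖y‖ / ‖x‖) ^ θ * (‖y‖ / ‖x‖) ^ (-θ) = 1 := by
      rw [← Real.rpow_add ht, add_neg_cancel, Real.rpow_zero]
    have e2 : ‖x‖ ^ (-θ) * (‖y‖ / ‖x‖) ^ (-θ) = ‖y‖ ^ (-θ) := by
      rw [← Real.mul_rpow hx0.le ht.le, mul_div_cancel₀ _ hx0.ne']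
    linear_combination ‖x‖ ^ (-θ) * e1 - e2
  rw [e, Real.mul_rpow (by positivity) (by positivity), Real.mul_rpow (by positivity) ht1,
    ← Real.rpow_mul ht.le, neg_mul, neg_mul]

lemma invPullback_pvIntegrand_eq (hp : 1 < p) (hε : 0 < ε) (hθ : 0 < θ) (hx : ε ≤ ‖x‖)
    (hy : y ∈ puncturedBall ‖x‖) :
    invPullback ‖x‖ (pvIntegrand N s p (truncPow N θ ε) x) y =
      (‖x‖ ^ (-θ)) ^ (p - 1) * (1 - (‖y‖ / ‖x‖) ^ θ) ^ (p - 1) *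
        (‖y‖ / ‖x‖) ^ (-(N - s * p)) * ‖x - y‖ ^ (-(N + s * p)) := by
  have hx0 : 0 < ‖x‖ := hε.trans_le hx
  obtain ⟨hy0, hyx⟩ := hy
  set t := ‖y‖ / ‖x‖ with ht_def
  have ht : 0 < t := by positivity
  have ht1 : 0 ≤ 1 - t ^ θ := sub_nonneg.2
    (Real.rpow_le_one ht.le ((div_le_one hx0).2 hyx.le) hθ.le)
  have hn : ‖EuclideanGeometry.inversion 0 ‖x‖ y‖ = ‖x‖ * t⁻¹ := by
    rw [norm_inversion_zero, ht_def]
    field_simp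
  have hd : ‖x - EuclideanGeometry.inversion 0 ‖x‖ y‖ = t⁻¹ * ‖x - y‖ := by
    rw [norm_sub_inversion_zero (norm_pos_iff.1 hx0) (norm_pos_iff.1 hy0), ht_def]
    field_simp
  have hle : ‖x‖ ≤ ‖EuclideanGeometry.inversion 0 ‖x‖ y‖ := by
    rw [norm_inversion_zero, le_div_iff₀ hy0]
    nlinarith
  have h := truncPow_anti (θ := θ) hε hθ (hx.trans hle) hle
  have e : ‖x‖ ^ (-θ) - (‖x‖ * t⁻¹) ^ (-θ) = ‖x‖ ^ (-θ) * (1 - t ^ θ) := by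
    rw [Real.mul_rpow hx0.le (by positivity), Real.inv_rpow ht.le, Real.rpow_neg ht.le, inv_inv]
    ring
  rw [invPullback, pvIntegrand, abs_rpow_sub_two_mul_of_nonneg (by linarith) hp,
    truncPow_of_le hx, truncPow_of_le (hx.trans hle), hn, hd, e,
    Real.mul_rpow (by positivity) ht1, Real.mul_rpow (by positivity) (norm_nonneg _)]
  have e3 : (‖x‖ / ‖y‖) ^ (2 * N) * (t⁻¹) ^ (-((N : ℝ) + s * p)) = t ^ (-((N : ℝ) - s * p)) := by
    rw [← inv_div, ← ht_def, Real.inv_rpow ht.le, Real.rpow_neg ht.le, inv_inv, inv_pow,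
      ← Real.rpow_natCast, ← Real.rpow_neg ht.le, ← Real.rpow_add ht]
    congr 1
    push_cast
    ring
  rw [← e3]
  ring

end

section

variable {N : ℕ} {s p θ ε : ℝ} {x : EuclideanSpace ℝ (Fin N)}

lemma pv_truncPow [NeZero N] (hs : 0 < s) (hs1 : s < 1) (hp : 1 < p)
    (hθ : 0 < θ) (hε : 0 < ε) (hε2 : ε ≤ 1 / 2) (hx : 1 ≤ ‖x‖) :
    IntegrableOn (fun y => pvIntegrand N s p (truncPow N θ ε) x y +
      invPullback ‖x‖ (pvIntegrand N s p (truncPow N θ ε) x) y) (puncturedBall ‖x‖) ∧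
    pvFracPLap N s p (truncPow N θ ε) x
      (∫ y in puncturedBall ‖x‖, (pvIntegrand N s p (truncPow N θ ε) x y +
        invPullback ‖x‖ (pvIntegrand N s p (truncPow N θ ε) x) y)) := by
  have hR : 0 < ‖x‖ := by linarith
  have hsp : 0 < s * p := mul_pos hs (by linarith)
  have hp1 : 0 < p - 1 := by linarith
  have hεx : ε ≤ ‖x‖ := by linarith
  obtain ⟨C₁, hC₁, h₁⟩ := exists_abs_one_sub_rpow_le θ
  obtain ⟨C₂, hC₂, h₂⟩ := exists_abs_one_sub_rpow_le (-(θ * (p - 1)))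
  obtain ⟨C₃, hC₃, h₃⟩ := exists_abs_one_sub_rpow_le (-((N : ℝ) - s * p))
  set A := (‖x‖ ^ (-θ)) ^ (p - 1)
  have hA : 0 ≤ A := by positivity
  have key : ∀ y ∈ puncturedBall ‖x‖, ‖x - y‖ < ‖x‖ / 2 →
      0 < ‖x - y‖ ∧ ε ≤ ‖y‖ ∧ ‖y‖ / ‖x‖ ∈ Icc (1 / 2 : ℝ) 1 ∧ 1 - ‖y‖ / ‖x‖ ≤ ‖x - y‖ ∧
        0 ≤ (1 - (‖y‖ / ‖x‖) ^ θ) ^ (p - 1) ∧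
        (1 - (‖y‖ / ‖x‖) ^ θ) ^ (p - 1) ≤ C₁ ^ (p - 1) * ‖x - y‖ ^ (p - 1) := by
    rintro y ⟨hy0, hyx⟩ hxy
    have hsub := norm_sub_norm_le x y
    have ht : ‖y‖ / ‖x‖ ∈ Icc (1 / 2 : ℝ) 1 :=
      ⟨by rw [le_div_iff₀ hR]; linarith, (div_le_one hR).2 hyx.le⟩
    have h1t : 1 - ‖y‖ / ‖x‖ ≤ ‖x - y‖ := by
      rw [one_sub_div hR.ne', div_le_iff₀ hR]
      nlinarith [norm_nonneg (x - y)]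
    have hnn : 0 ≤ 1 - (‖y‖ / ‖x‖) ^ θ := sub_nonneg.2
      (Real.rpow_le_one (by positivity) ht.2 hθ.le)
    refine ⟨by linarith, by linarith, ht, h1t, by positivity, ?_⟩
    rw [← Real.mul_rpow hC₁ (norm_nonneg _)]
    refine Real.rpow_le_rpow hnn ((le_abs_self _).trans ((h₁ _ ht).trans ?_)) hp1.le
    gcongr
  obtain ⟨hint, hlim⟩ := tendsto_pv_of_inversion (norm_pos_iff.1 hR)
    (measurable_pvIntegrand (s := s) (p := p) (θ := θ) (ε := ε) x)
    (fun r hr => integrableOn_pvIntegrand hs hp hε hθ x hr)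
    (ρ := ‖x‖ / 2) (C := A * C₁ ^ (p - 1) * (C₂ + C₃)) (a := N + s * p - p)
    (C' := A * C₁ ^ (p - 1) * (1 + C₃)) (b := p - 1) (c := N + s * p)
    (by positivity) (by nlinarith)
    (by
      intro y hy hxy
      obtain ⟨hxy0, hεy, ht, h1t, hh0, hh⟩ := key y hy hxy
      rw [pvIntegrand_eq hp hε hθ hεx hεy hy.2.le, invPullback_pvIntegrand_eq hp hε hθ hεx hy]
      set t := ‖y‖ / ‖x‖
      set h := (1 - t ^ θ) ^ (p - 1)
      have e : -(A * h * t ^ (-(θ * (p - 1))) * ‖x - y‖ ^ (-(N + s * p))) +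
          A * h * t ^ (-(N - s * p)) * ‖x - y‖ ^ (-(N + s * p)) =
          A * h * ((1 - t ^ (-(θ * (p - 1)))) - (1 - t ^ (-(N - s * p)))) *
            ‖x - y‖ ^ (-(N + s * p)) := by ring
      have hdiff : |(1 - t ^ (-(θ * (p - 1)))) - (1 - t ^ (-(N - s * p)))| ≤
          (C₂ + C₃) * ‖x - y‖ := by
        refine (abs_sub _ _).trans ((add_le_add (h₂ t ht) (h₃ t ht)).trans ?_)
        rw [← add_mul]
        gcongr
      have e2 : ‖x - y‖ ^ (-(N + s * p - p)) =
          ‖x - y‖ ^ (p - 1) * ‖x - y‖ * ‖x - y‖ ^ (-(N + s * p)) := by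
        nth_rewrite 3 [← Real.rpow_one ‖x - y‖]
        rw [← Real.rpow_add hxy0, ← Real.rpow_add hxy0]
        congr 1
        ring
      rw [e, e2, abs_mul, abs_mul, abs_of_nonneg (by positivity : 0 ≤ A * h),
        abs_of_nonneg (by positivity : 0 ≤ ‖x - y‖ ^ (-(N + s * p)))]
      calc A * h * |(1 - t ^ (-(θ * (p - 1)))) - (1 - t ^ (-(N - s * p)))| *
            ‖x - y‖ ^ (-(N + s * p))
          ≤ A * (C₁ ^ (p - 1) * ‖x - y‖ ^ (p - 1)) * ((C₂ + C₃) * ‖x - y‖) *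
            ‖x - y‖ ^ (-(N + s * p)) := by gcongr
        _ = _ := by ring)
    (by positivity) hp1.le (by positivity) (by nlinarith)
    (by
      intro y hy hxy
      obtain ⟨hxy0, hεy, ht, h1t, hh0, hh⟩ := key y hy hxy
      rw [invPullback_pvIntegrand_eq hp hε hθ hεx hy]
      set t := ‖y‖ / ‖x‖
      set h := (1 - t ^ θ) ^ (p - 1)
      have ht0 : 0 < t := by have := ht.1; linarith
      have hb : t ^ (-(N - s * p)) ≤ 1 + C₃ := by
        have h4 := (abs_le.1 (h₃ t ht)).1
        have h5 : C₃ * (1 - t) ≤ C₃ := by nlinarith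
        linarith
      rw [abs_of_nonneg (by positivity)]
      calc A * h * t ^ (-(N - s * p)) * ‖x - y‖ ^ (-(N + s * p))
          ≤ A * (C₁ ^ (p - 1) * ‖x - y‖ ^ (p - 1)) * (1 + C₃) * ‖x - y‖ ^ (-(N + s * p)) := by
            gcongr
        _ = _ := by ring)
  exact ⟨hint, fun r hr => integrableOn_pvIntegrand hs hp hε hθ x hr, hlim⟩

lemma pvIntegrand_add_invPullback_nonpos {y : EuclideanSpace ℝ (Fin N)} (hp : 1 < p)
    (hθ : 0 < θ) (hθs : N - s * p ≤ θ * (p - 1)) (hε : 0 < ε) (hx : ε ≤ ‖x‖) (hεy : ε ≤ ‖y‖)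
    (hy : y ∈ puncturedBall ‖x‖) :
    pvIntegrand N s p (truncPow N θ ε) x y +
      invPullback ‖x‖ (pvIntegrand N s p (truncPow N θ ε) x) y ≤ 0 := by
  have hR : 0 < ‖x‖ := hε.trans_le hx
  have ht0 : 0 < ‖y‖ / ‖x‖ := div_pos hy.1 hR
  have ht1 : ‖y‖ / ‖x‖ ≤ 1 := (div_le_one hR).2 hy.2.le
  have hnn : 0 ≤ 1 - (‖y‖ / ‖x‖) ^ θ := sub_nonneg.2 (Real.rpow_le_one ht0.le ht1 hθ.le)
  rw [pvIntegrand_eq hp hε hθ hx hεy hy.2.le, invPullback_pvIntegrand_eq hp hε hθ hx hy,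
    neg_add_nonpos_iff]
  have := Real.rpow_le_rpow_of_exponent_ge ht0 ht1 (neg_le_neg hθs)
  gcongr

/-- A uniform negative contribution, away from the origin and from the sphere through `x`. -/
lemma pvIntegrand_add_invPullback_le {y : EuclideanSpace ℝ (Fin N)} (hp : 1 < p)
    (hs : 0 < s) (hNsp : s * p < N) (hθ : 0 < θ) (hθs : N - s * p < θ * (p - 1)) (hε : 0 < ε)
    (hx : ε ≤ ‖x‖) (hεy : ε ≤ ‖y‖) (hyx : ‖y‖ ≤ ‖x‖ / 2) :
    pvIntegrand N s p (truncPow N θ ε) x y +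
      invPullback ‖x‖ (pvIntegrand N s p (truncPow N θ ε) x) y ≤
      -((‖x‖ ^ (-θ)) ^ (p - 1) * ((1 - (1 / 2 : ℝ) ^ θ) ^ (p - 1) *
        (2 ^ (θ * (p - 1) - (N - s * p)) - 1)) * (2 * ‖x‖) ^ (-(N + s * p))) := by
  have hR : 0 < ‖x‖ := hε.trans_le hx
  have hy : y ∈ puncturedBall ‖x‖ := ⟨hε.trans_le hεy, by linarith⟩
  have hsp : 0 < s * p := mul_pos hs (by linarith)
  have ht0 : 0 < ‖y‖ / ‖x‖ := div_pos hy.1 hR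
  have ht2 : ‖y‖ / ‖x‖ ≤ 1 / 2 := by rw [div_le_iff₀ hR]; linarith
  rw [pvIntegrand_eq hp hε hθ hx hεy hy.2.le, invPullback_pvIntegrand_eq hp hε hθ hx hy]
  set t := ‖y‖ / ‖x‖
  set A := (‖x‖ ^ (-θ)) ^ (p - 1)
  have hh : (1 - (1 / 2 : ℝ) ^ θ) ^ (p - 1) ≤ (1 - t ^ θ) ^ (p - 1) := by
    refine Real.rpow_le_rpow (sub_nonneg.2 (Real.rpow_le_one (by norm_num) (by norm_num) hθ.le))
      ?_ (by linarith)
    have := Real.rpow_le_rpow ht0.le ht2 hθ.le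
    linarith
  have hhalf : 0 ≤ 1 - (1 / 2 : ℝ) ^ θ :=
    sub_nonneg.2 (Real.rpow_le_one (by norm_num) (by norm_num) hθ.le)
  have h2 : (1 : ℝ) ≤ 2 ^ (θ * (p - 1) - (N - s * p)) :=
    Real.one_le_rpow (by norm_num) (by linarith)
  have hW : (2 * ‖x‖) ^ (-(N + s * p)) ≤ ‖x - y‖ ^ (-(N + s * p)) := by
    have hpos : 0 < ‖x - y‖ := by
      have := norm_sub_norm_le x y
      linarith
    refine Real.rpow_le_rpow_of_nonpos hpos ((norm_sub_le _ _).trans (by linarith))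
      (by linarith [(Nat.cast_nonneg N : (0 : ℝ) ≤ N)])
  have hd : 2 ^ (θ * (p - 1) - (N - s * p)) - 1 ≤
      t ^ (-(θ * (p - 1))) - t ^ (-(N - s * p)) := by
    have e : t ^ (-(θ * (p - 1))) =
        t ^ (-(N - s * p)) * t ^ (-(θ * (p - 1) - (N - s * p))) := by
      rw [← Real.rpow_add ht0]
      congr 1
      ring
    have e1 : (2 : ℝ) ^ (θ * (p - 1) - (N - s * p)) ≤ t ^ (-(θ * (p - 1) - (N - s * p))) := by
      have := Real.rpow_le_rpow_of_nonpos ht0 ht2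
        (by linarith : -(θ * (p - 1) - (N - s * p)) ≤ 0)
      rwa [Real.rpow_neg (by norm_num), one_div, Real.inv_rpow (by norm_num), inv_inv] at this
    have e2 : 1 ≤ t ^ (-(N - s * p)) :=
      Real.one_le_rpow_of_pos_of_le_one_of_nonpos ht0 (by linarith) (by linarith)
    rw [e]
    nlinarith
  have hm : A * ((1 - (1 / 2 : ℝ) ^ θ) ^ (p - 1) * (2 ^ (θ * (p - 1) - (N - s * p)) - 1)) *
      (2 * ‖x‖) ^ (-(N + s * p)) ≤
      A * ((1 - t ^ θ) ^ (p - 1) * (t ^ (-(θ * (p - 1))) - t ^ (-(N - s * p)))) *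
      ‖x - y‖ ^ (-(N + s * p)) := by
    have h2' : 0 ≤ (2 : ℝ) ^ (θ * (p - 1) - (N - s * p)) - 1 := by linarith
    have hh0 : 0 ≤ (1 - t ^ θ) ^ (p - 1) := (Real.rpow_nonneg hhalf _).trans hh
    exact mul_le_mul (mul_le_mul_of_nonneg_left (mul_le_mul hh hd h2' hh0) (by positivity)) hW
      (by positivity) (mul_nonneg (by positivity) (mul_nonneg hh0 (h2'.trans hd)))
  linarith

/-- A bound for the contribution near the origin. -/
lemma pvIntegrand_add_invPullback_le_of_norm_lt {y : EuclideanSpace ℝ (Fin N)} (hp : 1 < p)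
    (hs : 0 < s) (hθ : 0 < θ) (hε : 0 < ε)
    (hε2 : ε ≤ 1 / 2) (hx : 1 ≤ ‖x‖) (hεy : ‖y‖ < ε) (hy : y ∈ puncturedBall ‖x‖) :
    pvIntegrand N s p (truncPow N θ ε) x y +
      invPullback ‖x‖ (pvIntegrand N s p (truncPow N θ ε) x) y ≤
      (‖x‖ ^ (-θ)) ^ (p - 1) * 2 ^ (N + s * p) * ‖x‖ ^ (-(s * p)) * ‖y‖ ^ (-(N - s * p)) := by
  have hR : 0 < ‖x‖ := by linarith
  have hsp : 0 < s * p := mul_pos hs (by linarith)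
  have hN : (0 : ℝ) ≤ N := Nat.cast_nonneg N
  have ht0 : 0 < ‖y‖ / ‖x‖ := div_pos hy.1 hR
  have ht1 : ‖y‖ / ‖x‖ ≤ 1 := (div_le_one hR).2 hy.2.le
  have hF := pvIntegrand_nonpos (N := N) (s := s) hp hε hθ (by linarith : ε ≤ ‖x‖) hy.2.le
  refine (add_le_of_nonpos_left hF).trans ?_
  rw [invPullback_pvIntegrand_eq hp hε hθ (by linarith) hy]
  have hnn : 0 ≤ 1 - (‖y‖ / ‖x‖) ^ θ := sub_nonneg.2 (Real.rpow_le_one ht0.le ht1 hθ.le)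
  have hh : (1 - (‖y‖ / ‖x‖) ^ θ) ^ (p - 1) ≤ 1 :=
    Real.rpow_le_one hnn (by linarith [Real.rpow_pos_of_pos ht0 θ]) (by linarith)
  have hW : ‖x - y‖ ^ (-(N + s * p)) ≤ (‖x‖ / 2) ^ (-(N + s * p)) :=
    Real.rpow_le_rpow_of_nonpos (by linarith)
      (by linarith [norm_sub_norm_le x y]) (by linarith)
  have e1 : (‖y‖ / ‖x‖) ^ (-(N - s * p)) = ‖y‖ ^ (-(N - s * p)) * ‖x‖ ^ (N - s * p) := by
    rw [Real.div_rpow hy.1.le hR.le, Real.rpow_neg hR.le, div_inv_eq_mul]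
  have e2 : (‖x‖ / 2) ^ (-(N + s * p)) = ‖x‖ ^ (-(N + s * p)) * 2 ^ (N + s * p) := by
    rw [Real.div_rpow hR.le (by norm_num), Real.rpow_neg (by norm_num : (0 : ℝ) ≤ 2),
      div_inv_eq_mul]
  have e3 : ‖x‖ ^ (N - s * p) * ‖x‖ ^ (-(N + s * p)) ≤ ‖x‖ ^ (-(s * p)) := by
    rw [← Real.rpow_add hR]
    exact Real.rpow_le_rpow_of_exponent_le hx (by linarith)
  set A := (‖x‖ ^ (-θ)) ^ (p - 1)
  calc A * (1 - (‖y‖ / ‖x‖) ^ θ) ^ (p - 1) * (‖y‖ / ‖x‖) ^ (-(N - s * p)) *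
        ‖x - y‖ ^ (-(N + s * p))
      ≤ A * 1 * (‖y‖ / ‖x‖) ^ (-(N - s * p)) * (‖x‖ / 2) ^ (-(N + s * p)) := by gcongr
    _ = A * 2 ^ (N + s * p) * (‖x‖ ^ (N - s * p) * ‖x‖ ^ (-(N + s * p))) *
        ‖y‖ ^ (-(N - s * p)) := by rw [e1, e2]; ring
    _ ≤ _ := by gcongr

end

lemma exists_setIntegral_ball_norm_rpow_lt {N : ℕ} [NeZero N] {a : ℝ} (ha : a < N) {η : ℝ}
    (hη : 0 < η) : ∃ ε : ℝ, 0 < ε ∧ ε ≤ 1 / 4 ∧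
      IntegrableOn (fun y : EuclideanSpace ℝ (Fin N) => ‖y‖ ^ (-a)) (Metric.ball 0 ε) ∧
      ∫ y in Metric.ball (0 : EuclideanSpace ℝ (Fin N)) ε, ‖y‖ ^ (-a) < η := by
  have hint : ∀ ε : ℝ,
      IntegrableOn (fun y : EuclideanSpace ℝ (Fin N) => ‖y‖ ^ (-a)) (Metric.ball 0 ε) :=
    fun ε => by simpa using integrableOn_ball_norm_sub_rpow (0 : EuclideanSpace ℝ (Fin N)) ha ε
  have ht := tendsto_setIntegral_of_antitone (μ := volume)
    (s := fun n : ℕ => Metric.ball (0 : EuclideanSpace ℝ (Fin N)) (1 / (n + 1)))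
    (f := fun y => ‖y‖ ^ (-a)) (fun _ => Metric.isOpen_ball.measurableSet)
    (fun m n hmn => Metric.ball_subset_ball (by gcongr)) ⟨0, hint _⟩
  have h0 : volume (⋂ n : ℕ, Metric.ball (0 : EuclideanSpace ℝ (Fin N)) (1 / (n + 1))) = 0 := by
    refine measure_mono_null (t := {0}) (fun y hy => ?_) (measure_singleton 0)
    rw [mem_iInter] at hy
    by_contra hne
    obtain ⟨n, hn⟩ := exists_nat_one_div_lt (norm_pos_iff.2 hne)
    exact lt_asymm hn (by simpa using hy n)
  rw [setIntegral_measure_zero _ h0] at ht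
  obtain ⟨n, hn3, hn⟩ := ((eventually_ge_atTop 3).and (ht.eventually (gt_mem_nhds hη))).exists
  refine ⟨1 / (n + 1), by positivity, ?_, hint _, hn⟩
  have : (3 : ℝ) ≤ n := by exact_mod_cast hn3
  exact one_div_le_one_div_of_le (by norm_num) (by linarith)

/-- For `θ ∈ ((N-sp)/(p-1), N/(p-1))`, there exists `ε₀ ∈ (0, 1/2]` such that the
truncated power function `φ_θ` satisfies `(-Δ_p)^s φ_θ (x) < 0` for `|x| ≥ 1`. -/
theorem stmt_5 (N : ℕ) (hN : 2 ≤ N) (s p θ : ℝ)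
    (hs : 0 < s) (hs1 : s < 1) (hp : 1 < p)
    (hNsp : s * p < N)
    (hθ0 : ((N : ℝ) - s * p) / (p - 1) < θ) (hθ1 : θ < (N : ℝ) / (p - 1)) :
    ∃ ε₀ : ℝ, 0 < ε₀ ∧ ε₀ ≤ 1 / 2 ∧
      ∀ x : EuclideanSpace ℝ (Fin N), 1 ≤ ‖x‖ →
        ∃ L : ℝ, pvFracPLap N s p (truncPow N θ ε₀) x L ∧ L < 0 := by
  have : NeZero N := ⟨by lia⟩
  have hsp : 0 < s * p := mul_pos hs (by linarith)
  have hp1 : 0 < p - 1 := by linarith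
  rw [div_lt_iff₀ hp1] at hθ0
  have hθ : 0 < θ := pos_of_mul_pos_left (by linarith : 0 < θ * (p - 1)) hp1.le
  set c : ℝ := (1 - (1 / 2 : ℝ) ^ θ) ^ (p - 1) * (2 ^ (θ * (p - 1) - (N - s * p)) - 1) with hc_def
  have hc : 0 < c := mul_pos
    (Real.rpow_pos_of_pos (sub_pos.2 (Real.rpow_lt_one (by norm_num) (by norm_num) hθ)) _)
    (sub_pos.2 (Real.one_lt_rpow (by norm_num) (by linarith)))
  set V := volume.real (Metric.ball (0 : EuclideanSpace ℝ (Fin N)) 1)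
  have hV : 0 < V := ENNReal.toReal_pos (Metric.measure_ball_pos volume _ one_pos).ne'
    Metric.isBounded_ball.measure_lt_top.ne
  obtain ⟨ε, hε, hε4, hJi, hJ⟩ := exists_setIntegral_ball_norm_rpow_lt (N := N)
    (by linarith : (N : ℝ) - s * p < N)
    (by positivity : 0 < c * 2 ^ (-(N + s * p)) * 2 ^ (-(N + s * p)) * V / 8 ^ N)
  refine ⟨ε, hε, by linarith, fun x hx => ?_⟩
  have hR : 0 < ‖x‖ := by linarith
  have hεx : ε ≤ ‖x‖ := by linarith
  obtain ⟨hint, hpv⟩ := pv_truncPow hs hs1 hp hθ hε (by linarith : ε ≤ 1 / 2) hx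
  refine ⟨_, hpv, ?_⟩
  set A := (‖x‖ ^ (-θ)) ^ (p - 1) with hA_def
  have hA : 0 < A := by positivity
  set K := A * 2 ^ (N + s * p) * ‖x‖ ^ (-(s * p))
  set k := A * c * (2 * ‖x‖) ^ (-(N + s * p))
  have hk : 0 < k := by positivity
  set Q := Metric.closedBall ((3 / 8 : ℝ) • x) (‖x‖ / 8)
  have hQ : ∀ y ∈ Q, ‖x‖ / 4 ≤ ‖y‖ ∧ ‖y‖ ≤ ‖x‖ / 2 := by
    intro y hy
    have h1 : ‖y - (3 / 8 : ℝ) • x‖ ≤ ‖x‖ / 8 := by rwa [← dist_eq_norm]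
    have h2 : ‖(3 / 8 : ℝ) • x‖ = 3 / 8 * ‖x‖ := by rw [norm_smul]; norm_num
    have h3 := norm_sub_norm_le y ((3 / 8 : ℝ) • x)
    have h4 := norm_sub_norm_le ((3 / 8 : ℝ) • x) y
    rw [norm_sub_rev] at h4
    constructor <;> linarith
  have hQD : Q ⊆ puncturedBall ‖x‖ := fun y hy =>
    ⟨by linarith [(hQ y hy).1], by linarith [(hQ y hy).2]⟩
  have hQm : MeasurableSet Q := Metric.isClosed_closedBall.measurableSet
  have hbm : MeasurableSet (Metric.ball (0 : EuclideanSpace ℝ (Fin N)) ε) :=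
    Metric.isOpen_ball.measurableSet
  have hi1 : Integrable ((Metric.ball (0 : EuclideanSpace ℝ (Fin N)) ε).indicator
      fun y => K * ‖y‖ ^ (-((N : ℝ) - s * p))) :=
    (integrable_indicator_iff hbm).2 (hJi.const_mul K)
  have hi2 : Integrable (Q.indicator fun _ => k) :=
    (integrable_indicator_iff hQm).2
      (integrableOn_const Metric.isBounded_closedBall.measure_lt_top.ne)
  have hle : ∀ y ∈ puncturedBall ‖x‖, pvIntegrand N s p (truncPow N θ ε) x y +
      invPullback ‖x‖ (pvIntegrand N s p (truncPow N θ ε) x) y ≤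
      (Metric.ball (0 : EuclideanSpace ℝ (Fin N)) ε).indicator
        (fun y => K * ‖y‖ ^ (-((N : ℝ) - s * p))) y - Q.indicator (fun _ => k) y := by
    intro y hy
    rcases lt_or_ge ‖y‖ ε with h | h
    · have hyQ : y ∉ Q := fun hyQ => by linarith [(hQ y hyQ).1]
      rw [indicator_of_mem (by simpa using h), indicator_of_notMem hyQ, sub_zero]
      exact pvIntegrand_add_invPullback_le_of_norm_lt hp hs hθ hε (by linarith) hx h hy
    · rw [indicator_of_notMem (by simpa using h), zero_sub]
      by_cases hyQ : y ∈ Q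
      · rw [indicator_of_mem hyQ]
        exact pvIntegrand_add_invPullback_le hp hs hNsp hθ hθ0 hε hεx h (hQ y hyQ).2
      · rw [indicator_of_notMem hyQ, neg_zero]
        exact pvIntegrand_add_invPullback_nonpos hp hθ hθ0.le hε hεx h hy
  have hQint : ∫ y in puncturedBall ‖x‖, Q.indicator (fun _ => k) y = (‖x‖ / 8) ^ N * V * k := by
    rw [setIntegral_indicator hQm, inter_eq_self_of_subset_right hQD, setIntegral_const,
      smul_eq_mul, Measure.addHaar_real_closedBall _ _ (by positivity),
      finrank_euclideanSpace_fin]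
  have hpow : ‖x‖ ^ N * ‖x‖ ^ (-(N + s * p)) = ‖x‖ ^ (-(s * p)) := by
    rw [← Real.rpow_natCast, ← Real.rpow_add hR]
    congr 1
    ring
  have htwo : (2 : ℝ) ^ (N + s * p) * 2 ^ (-(N + s * p)) = 1 := by
    rw [← Real.rpow_add two_pos, add_neg_cancel, Real.rpow_zero]
  calc ∫ y in puncturedBall ‖x‖, (pvIntegrand N s p (truncPow N θ ε) x y +
        invPullback ‖x‖ (pvIntegrand N s p (truncPow N θ ε) x) y)
      ≤ ∫ y in puncturedBall ‖x‖, ((Metric.ball (0 : EuclideanSpace ℝ (Fin N)) ε).indicator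
        (fun y => K * ‖y‖ ^ (-((N : ℝ) - s * p))) y - Q.indicator (fun _ => k) y) :=
        setIntegral_mono_on hint (hi1.sub hi2).integrableOn (measurableSet_puncturedBall _) hle
    _ = (∫ y in puncturedBall ‖x‖, (Metric.ball (0 : EuclideanSpace ℝ (Fin N)) ε).indicator
        (fun y => K * ‖y‖ ^ (-((N : ℝ) - s * p))) y) - (‖x‖ / 8) ^ N * V * k := by
        rw [integral_sub hi1.integrableOn hi2.integrableOn, hQint]
    _ ≤ K * (∫ y in Metric.ball (0 : EuclideanSpace ℝ (Fin N)) ε, ‖y‖ ^ (-((N : ℝ) - s * p))) -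
        (‖x‖ / 8) ^ N * V * k := by
        rw [← integral_const_mul, ← integral_indicator hbm]
        refine sub_le_sub_right (setIntegral_le_integral hi1 (Eventually.of_forall fun y => ?_)) _
        exact indicator_nonneg (fun _ _ => by positivity) y
    _ < K * (c * 2 ^ (-(N + s * p)) * 2 ^ (-(N + s * p)) * V / 8 ^ N) -
        (‖x‖ / 8) ^ N * V * k := by gcongr
    _ = 0 := by
        simp only [K, k]
        rw [Real.mul_rpow two_pos.le hR.le, div_pow, ← hpow]
        linear_combination (A * ‖x‖ ^ N * ‖x‖ ^ (-(N + s * p)) * c *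
          2 ^ (-(N + s * p)) * V / 8 ^ N) * htwo
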